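/- arXiv:2209.05359 — 2 statements merged into one kernel-verified Lean document; each statement's English description precedes it below -/
import Mathlib

section
/- Let (G_1, ..., G_m), with m ≥ 1, be a (redundant or non-redundant) decomposition of a data graph G and let Q be a query graph. Then e is a total embedding of Q in G if and only if there exist indices 1 ≤ i_1 < ... < i_k ≤ m and mutually compatible useful partial embeddings e_1, ..., e_k of Q in G_{i_1}, ..., G_{i_k} respectively, satisfying: (a) for every triple (v, p, u) ∈ Q there exists some j for which e_j(v) and e_j(u) are defined and (e_j(v), p, e_j(u)) ∈ G_{i_j}; and (b) the join of e_1, ..., e_k equals e. -/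
namespace RDF

variable {α β : Type*}

/-- The nodes (subjects and objects) of a set of triples. -/
def Nodes (F : Set (α × β × α)) : Set α :=
  {v | (∃ p o, (v, p, o) ∈ F) ∨ (∃ s p, (s, p, v) ∈ F)}

/-- The background setting: `Uso` (URI references used as subjects/objects), `L` (literals)
and `V` (variables) are countably infinite and pairwise disjoint subsets of `α`;
the predicate URIs form the (separate) type `β`. -/
def Setting (Uso L V : Set α) : Prop :=
  Uso.Countable ∧ Uso.Infinite ∧ L.Countable ∧ L.Infinite ∧ V.Countable ∧ V.Infinite ∧
    Disjoint Uso L ∧ Disjoint Uso V ∧ Disjoint L V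

/-- `G` is a data graph: a nonempty set of data triples. -/
def IsDataGraph (Uso L : Set α) (G : Set (α × β × α)) : Prop :=
  G.Nonempty ∧ ∀ t ∈ G, t.1 ∈ Uso ∧ t.2.2 ∈ Uso ∪ L

/-- `Q` is a query graph: a nonempty set of query triples. -/
def IsQueryGraph (Uso L V : Set α) (Q : Set (α × β × α)) : Prop :=
  Q.Nonempty ∧ ∀ t ∈ Q, t.1 ∈ Uso ∪ V ∧ t.2.2 ∈ Uso ∪ L ∪ V

/-- Partial mappings are modeled as functions `α → Option α`.  A total embedding of `Q`
in `G` is defined exactly on the nodes of `Q`, takes values in the nodes of `G`,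
is the identity on non-variables, and maps every triple of `Q` to a triple of `G`. -/
def IsTotalEmbedding (V : Set α) (Q G : Set (α × β × α)) (e : α → Option α) : Prop :=
  (∀ v, (e v).isSome ↔ v ∈ Nodes Q) ∧
    (∀ v a, e v = some a → a ∈ Nodes G) ∧
    (∀ v ∈ Nodes Q, v ∉ V → e v = some v) ∧
    (∀ s p o, (s, p, o) ∈ Q → ∃ s' o', e s = some s' ∧ e o = some o' ∧ (s', p, o') ∈ G)

/-- A partial embedding of `Q` in `G`. -/
def IsPartialEmbedding (V : Set α) (Q G : Set (α × β × α)) (e : α → Option α) : Prop :=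
  (∀ v, (e v).isSome → v ∈ Nodes Q) ∧
    (∀ v a, e v = some a → a ∈ Nodes G) ∧
    (∀ v a, e v = some a → v ∉ V → a = v) ∧
    (∀ v a, e v = some a → v ∈ V →
      ∃ u u' p, e u = some u' ∧
        (((v, p, u) ∈ Q ∧ (a, p, u') ∈ G) ∨ ((u, p, v) ∈ Q ∧ (u', p, a) ∈ G)))

/-- A partial embedding is non-trivial if it maps at least one triple of `Q` into `G`. -/
def NonTrivial (Q G : Set (α × β × α)) (e : α → Option α) : Prop :=
  ∃ v₁ p v₂ a b, (v₁, p, v₂) ∈ Q ∧ e v₁ = some a ∧ e v₂ = some b ∧ (a, p, b) ∈ G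

/-- Two partial mappings are compatible if they agree wherever both are defined. -/
def Compatible (e₁ e₂ : α → Option α) : Prop :=
  ∀ v a b, e₁ v = some a → e₂ v = some b → a = b

/-- The join of two partial mappings (the first takes precedence where defined). -/
def join (e₁ e₂ : α → Option α) : α → Option α :=
  fun v => (e₁ v).elim (e₂ v) some

/-- `e` is the join of the mutually compatible family `f` of partial mappings:
`e` is defined at `v` with value `a` iff some member of the family is. -/
def IsJoin {ι : Type*} (f : ι → α → Option α) (e : α → Option α) : Prop :=
  ∀ v a, e v = some a ↔ ∃ i, f i v = some a

/-- `seg` is a decomposition of the graph `F` into (nonempty) segments. -/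
def IsDecomposition {m : ℕ} (F : Set (α × β × α)) (seg : Fin m → Set (α × β × α)) : Prop :=
  (∀ i, (seg i).Nonempty) ∧ (∀ i, seg i ⊆ F) ∧ (⋃ i, seg i) = F

/-- A decomposition is non-redundant if its segments are pairwise disjoint. -/
def NonRedundant {m : ℕ} (seg : Fin m → Set (α × β × α)) : Prop :=
  ∀ i j, i ≠ j → seg i ∩ seg j = ∅

/-- Border nodes of two segments. -/
def BorderPair (L : Set α) (F₁ F₂ : Set (α × β × α)) : Set α :=
  (Nodes F₁ ∩ Nodes F₂) \ L

/-- Border nodes of segment `i` of a decomposition. -/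
def Border {m : ℕ} (L : Set α) (seg : Fin m → Set (α × β × α)) (i : Fin m) : Set α :=
  ⋃ j ∈ {j : Fin m | j ≠ i}, BorderPair L (seg i) (seg j)

/-- Useful partial embedding of `Q` in the segment `seg i` of a decomposition. -/
def IsUseful {m : ℕ} (V L : Set α) (Q : Set (α × β × α))
    (seg : Fin m → Set (α × β × α)) (i : Fin m) (e : α → Option α) : Prop :=
  IsPartialEmbedding V Q (seg i) e ∧
    NonTrivial Q (seg i) e ∧
    (∀ v ∈ Nodes Q ∩ Nodes (seg i), (e v).isSome) ∧
    (∀ v p u a, (v, p, u) ∈ Q → e v = some a → a ∉ Border L seg i ∪ L →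
      ∃ b, e u = some b ∧ (a, p, b) ∈ seg i) ∧
    (∀ v p u b, (v, p, u) ∈ Q → e u = some b → b ∉ Border L seg i ∪ L →
      ∃ a, e v = some a ∧ (a, p, b) ∈ seg i)

/-- Generalized star query with central node `c`. -/
def IsGenStar (Q : Set (α × β × α)) (c : α) : Prop :=
  c ∈ Nodes Q ∧ ∀ t ∈ Q, t.1 = c ∨ t.2.2 = c

/-- Subject-object star query (so-query) with central node `c`. -/
def IsSOStar (Q : Set (α × β × α)) (c : α) : Prop :=
  IsGenStar Q c ∧ ∃ t ∈ Q, t.1 = c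

/-- `W` is a node cover of `Q`. -/
def IsNodeCover (L : Set α) (Q : Set (α × β × α)) (W : Set α) : Prop :=
  W ⊆ Nodes Q \ L ∧ ∀ t ∈ Q, t.1 ∈ W ∨ t.2.2 ∈ W

/-- `N` is a partition (into nonempty blocks) of the non-literal nodes of `G`. -/
def IsPartitionOfNodes {m : ℕ} (L : Set α) (G : Set (α × β × α)) (N : Fin m → Set α) : Prop :=
  (∀ i, (N i).Nonempty) ∧ (⋃ i, N i) = Nodes G \ L ∧ ∀ i j, i ≠ j → N i ∩ N j = ∅

/-- The `i`-th segment of the s-decomposition of `G` determined by the node partition `N`. -/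
def sSeg {m : ℕ} (G : Set (α × β × α)) (N : Fin m → Set α) (i : Fin m) : Set (α × β × α) :=
  {t | t ∈ G ∧ (t.1 ∈ N i ∨ t.2.2 ∈ N i)}

/-- Replicated node of the `i`-th s-segment. -/
def ReplicatedNode {m : ℕ} (L : Set α) (G : Set (α × β × α)) (N : Fin m → Set α)
    (i : Fin m) (v : α) : Prop :=
  v ∈ Nodes (sSeg G N i) ∧ v ∉ L ∧ v ∉ N i

/-- Replicated triple of the `i`-th s-segment. -/
def ReplicatedTriple {m : ℕ} (L : Set α) (G : Set (α × β × α)) (N : Fin m → Set α)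
    (i : Fin m) (t : α × β × α) : Prop :=
  t ∈ sSeg G N i ∧ (ReplicatedNode L G N i t.1 ∨ ReplicatedNode L G N i t.2.2)

open Classical in
/-- Restriction of a partial mapping to a set. -/
noncomputable def restrictTo (S : Set α) (e : α → Option α) : α → Option α :=
  fun v => if v ∈ S then e v else none

/-- The answer determined by an embedding: its restriction to the variables. -/
noncomputable def answerOf (V : Set α) (e : α → Option α) : α → Option α :=
  restrictTo V e

/-- The set of answers of `Q` over `G`. -/
def Answers (V : Set α) (Q G : Set (α × β × α)) : Set (α → Option α) :=
  {a | ∃ e, IsTotalEmbedding V Q G e ∧ a = answerOf V e}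

theorem Nodes.of_subject {F : Set (α × β × α)} {s o : α} {p : β} (h : (s, p, o) ∈ F) :
    s ∈ Nodes F :=
  Or.inl ⟨p, o, h⟩

theorem Nodes.of_object {F : Set (α × β × α)} {s o : α} {p : β} (h : (s, p, o) ∈ F) :
    o ∈ Nodes F :=
  Or.inr ⟨s, p, h⟩

theorem Nodes.mono {F G : Set (α × β × α)} (h : F ⊆ G) : Nodes F ⊆ Nodes G := by
  rintro v (⟨p, o, hv⟩ | ⟨s, p, hv⟩)
  · exact Nodes.of_subject (h hv)
  · exact Nodes.of_object (h hv)

theorem mem_border {m : ℕ} {L : Set α} {seg : Fin m → Set (α × β × α)} {i j : Fin m} {a : α}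
    (hij : j ≠ i) (hi : a ∈ Nodes (seg i)) (hj : a ∈ Nodes (seg j)) (hL : a ∉ L) :
    a ∈ Border L seg i :=
  Set.mem_biUnion (x := j) hij ⟨⟨hi, hj⟩, hL⟩

theorem IsDataGraph.notMem_of_mem_nodes {Uso L V : Set α} (hset : Setting Uso L V)
    {G : Set (α × β × α)} (hG : IsDataGraph Uso L G) {v : α} (hv : v ∈ Nodes G) : v ∉ V := by
  obtain ⟨-, -, -, -, -, -, -, hUV, hLV⟩ := hset
  intro hV
  rcases hv with ⟨p, o, h⟩ | ⟨s, p, h⟩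
  · exact Set.disjoint_left.mp hUV (hG.2 _ h).1 hV
  · rcases (hG.2 _ h).2 with h | h
    · exact Set.disjoint_left.mp hUV h hV
    · exact Set.disjoint_left.mp hLV h hV

/-- The triple `t` of `Q` is mapped by `e` to a triple of `G`. -/
def MapsInto (G : Set (α × β × α)) (e : α → Option α) (t : α × β × α) : Prop :=
  ∃ a b, e t.1 = some a ∧ e t.2.2 = some b ∧ (a, t.2.1, b) ∈ G

/-- The nodes of `Q` on which the part of `e` living in `G` is defined: the ends of the triples
mapped into `G`, and the nodes shared by `Q` and `G`. -/
def localDomain (Q G : Set (α × β × α)) (e : α → Option α) : Set α :=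
  Nodes {t ∈ Q | MapsInto G e t} ∪ Nodes Q ∩ Nodes G

theorem restrictTo_eq_some {S : Set α} {e : α → Option α} {v a : α} :
    restrictTo S e v = some a ↔ v ∈ S ∧ e v = some a := by
  simp [restrictTo]

theorem localDomain_subset {Q G : Set (α × β × α)} {e : α → Option α} :
    localDomain Q G e ⊆ Nodes Q :=
  Set.union_subset (Nodes.mono (Set.sep_subset _ _)) Set.inter_subset_left

theorem mem_localDomain_of_mapsInto {Q G : Set (α × β × α)} {e : α → Option α} {v u : α} {p : β}
    (hQ : (v, p, u) ∈ Q) (h : MapsInto G e (v, p, u)) :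
    v ∈ localDomain Q G e ∧ u ∈ localDomain Q G e :=
  ⟨Or.inl (Nodes.of_subject ⟨hQ, h⟩), Or.inl (Nodes.of_object ⟨hQ, h⟩)⟩

/-- If a total embedding maps some triple of `Q` into the `i`-th segment, then its restriction
to the local domain of this segment is a useful partial embedding. -/
theorem IsTotalEmbedding.isUseful_restrictTo {Uso L V : Set α} (hset : Setting Uso L V)
    {m : ℕ} {G : Set (α × β × α)} (hG : IsDataGraph Uso L G)
    {seg : Fin m → Set (α × β × α)} (hseg : IsDecomposition G seg)
    {Q : Set (α × β × α)} {e : α → Option α} (he : IsTotalEmbedding V Q G e) {i : Fin m}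
    (hi : ∃ t ∈ Q, MapsInto (seg i) e t) :
    IsUseful V L Q seg i (restrictTo (localDomain Q (seg i) e) e) := by
  obtain ⟨hdom, -, hconst, htriple⟩ := he
  have hshared : ∀ v ∈ Nodes Q ∩ Nodes (seg i), v ∉ V ∧ e v = some v := fun v hv =>
    have hV := hG.notMem_of_mem_nodes hset (Nodes.mono (hseg.2.1 i) hv.2)
    ⟨hV, hconst v hv.1 hV⟩
  have hval : ∀ v a, restrictTo (localDomain Q (seg i) e) e v = some a → a ∈ Nodes (seg i) := by
    intro v a h
    obtain ⟨hv, hva⟩ := restrictTo_eq_some.mp h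
    rcases hv with (⟨p, u, -, b, c, hb, hc, hbc⟩ | ⟨u, p, -, b, c, hb, hc, hbc⟩) | hv
    · obtain rfl : b = a := Option.some.inj (hb.symm.trans hva)
      exact Nodes.of_subject hbc
    · obtain rfl : c = a := Option.some.inj (hc.symm.trans hva)
      exact Nodes.of_object hbc
    · obtain rfl : v = a := Option.some.inj ((hshared v hv).2.symm.trans hva)
      exact hv.2
  have hseg_of : ∀ {a b : α} {p : β}, (a, p, b) ∈ G → ∃ j, (a, p, b) ∈ seg j := by
    intro a b p h
    rwa [← hseg.2.2, Set.mem_iUnion] at h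
  refine ⟨⟨?_, hval, ?_, ?_⟩, ?_, ?_, ?_, ?_⟩
  · intro v hv
    obtain ⟨a, ha⟩ := Option.isSome_iff_exists.mp hv
    exact localDomain_subset (restrictTo_eq_some.mp ha).1
  · intro v a h hV
    obtain ⟨hv, hva⟩ := restrictTo_eq_some.mp h
    exact Option.some.inj (hva.symm.trans (hconst v (localDomain_subset hv) hV))
  · intro v a h hV
    obtain ⟨hv, hva⟩ := restrictTo_eq_some.mp h
    rcases hv with (⟨p, u, hQ, hm⟩ | ⟨u, p, hQ, hm⟩) | hv
    · have hmem := mem_localDomain_of_mapsInto hQ hm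
      obtain ⟨b, c, hb, hc, hbc⟩ := hm
      obtain rfl : b = a := Option.some.inj (hb.symm.trans hva)
      exact ⟨u, c, p, restrictTo_eq_some.mpr ⟨hmem.2, hc⟩, Or.inl ⟨hQ, hbc⟩⟩
    · have hmem := mem_localDomain_of_mapsInto hQ hm
      obtain ⟨b, c, hb, hc, hbc⟩ := hm
      obtain rfl : c = a := Option.some.inj (hc.symm.trans hva)
      exact ⟨u, b, p, restrictTo_eq_some.mpr ⟨hmem.1, hb⟩, Or.inr ⟨hQ, hbc⟩⟩
    · exact absurd hV (hshared v hv).1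
  · obtain ⟨⟨v, p, u⟩, hQ, hm⟩ := hi
    have hmem := mem_localDomain_of_mapsInto hQ hm
    obtain ⟨a, b, ha, hb, hab⟩ := hm
    exact ⟨v, p, u, a, b, hQ, restrictTo_eq_some.mpr ⟨hmem.1, ha⟩,
      restrictTo_eq_some.mpr ⟨hmem.2, hb⟩, hab⟩
  · intro v hv
    exact Option.isSome_iff_exists.mpr
      ⟨v, restrictTo_eq_some.mpr ⟨Or.inr hv, (hshared v hv).2⟩⟩
  · intro v p u a hQ h hborder
    have hva := (restrictTo_eq_some.mp h).2
    obtain ⟨a', b, ha', hb, hab⟩ := htriple v p u hQ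
    obtain rfl : a' = a := Option.some.inj (ha'.symm.trans hva)
    obtain ⟨j, hj⟩ := hseg_of hab
    obtain rfl : j = i := by
      by_contra hji
      exact hborder (Or.inl (mem_border hji (hval v a' h) (Nodes.of_subject hj)
        fun hL => hborder (Or.inr hL)))
    exact ⟨b, restrictTo_eq_some.mpr
      ⟨(mem_localDomain_of_mapsInto hQ ⟨a', b, ha', hb, hj⟩).2, hb⟩, hj⟩
  · intro v p u b hQ h hborder
    have hub := (restrictTo_eq_some.mp h).2
    obtain ⟨a, b', ha, hb', hab⟩ := htriple v p u hQ
    obtain rfl : b' = b := Option.some.inj (hb'.symm.trans hub)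
    obtain ⟨j, hj⟩ := hseg_of hab
    obtain rfl : j = i := by
      by_contra hji
      exact hborder (Or.inl (mem_border hji (hval u b' h) (Nodes.of_object hj)
        fun hL => hborder (Or.inr hL)))
    exact ⟨a, restrictTo_eq_some.mpr
      ⟨(mem_localDomain_of_mapsInto hQ ⟨a, b', ha, hb', hj⟩).1, ha⟩, hj⟩

/-- The join of partial embeddings in subgraphs of `G` that together cover every triple of `Q`
is a total embedding. -/
theorem isTotalEmbedding_of_isJoin {ι : Type*} {V : Set α} {Q G : Set (α × β × α)}
    {H : ι → Set (α × β × α)} (hH : ∀ j, H j ⊆ G) {f : ι → α → Option α} {e : α → Option α}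
    (hf : ∀ j, IsPartialEmbedding V Q (H j) (f j))
    (hcover : ∀ v p u, (v, p, u) ∈ Q →
      ∃ j a b, f j v = some a ∧ f j u = some b ∧ (a, p, b) ∈ H j)
    (hjoin : IsJoin f e) : IsTotalEmbedding V Q G e := by
  have hdef : ∀ v ∈ Nodes Q, ∃ j a, f j v = some a := by
    rintro v (⟨p, u, h⟩ | ⟨u, p, h⟩)
    · obtain ⟨j, a, b, ha, -⟩ := hcover _ _ _ h
      exact ⟨j, a, ha⟩
    · obtain ⟨j, a, b, -, hb, -⟩ := hcover _ _ _ h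
      exact ⟨j, b, hb⟩
  refine ⟨fun v => ⟨fun h => ?_, fun h => ?_⟩, fun v a h => ?_, fun v hv hV => ?_,
    fun s p o h => ?_⟩
  · obtain ⟨a, ha⟩ := Option.isSome_iff_exists.mp h
    obtain ⟨j, hj⟩ := (hjoin v a).mp ha
    exact (hf j).1 v (Option.isSome_iff_exists.mpr ⟨a, hj⟩)
  · obtain ⟨j, a, ha⟩ := hdef v h
    exact Option.isSome_iff_exists.mpr ⟨a, (hjoin v a).mpr ⟨j, ha⟩⟩
  · obtain ⟨j, hj⟩ := (hjoin v a).mp h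
    exact Nodes.mono (hH j) ((hf j).2.1 v a hj)
  · obtain ⟨j, a, ha⟩ := hdef v hv
    obtain rfl := (hf j).2.2.1 v a ha hV
    exact (hjoin a a).mpr ⟨j, ha⟩
  · obtain ⟨j, a, b, ha, hb, hab⟩ := hcover s p o h
    exact ⟨a, b, (hjoin s a).mpr ⟨j, ha⟩, (hjoin o b).mpr ⟨j, hb⟩, hH j hab⟩

/-- Lemma: total embeddings vs. useful partial embeddings over a data
graph decomposition. -/
theorem statement0 {α β : Type*} [Countable β] [Infinite β]
    {Uso L V : Set α} (hset : Setting Uso L V)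
    {m : ℕ} (hm : 1 ≤ m)
    {G : Set (α × β × α)} (hG : IsDataGraph Uso L G)
    {seg : Fin m → Set (α × β × α)} (hseg : IsDecomposition G seg)
    {Q : Set (α × β × α)} (hQ : IsQueryGraph Uso L V Q)
    (e : α → Option α) :
    IsTotalEmbedding V Q G e ↔
      ∃ (k : ℕ) (idx : Fin k → Fin m) (f : Fin k → α → Option α),
        StrictMono idx ∧
        (∀ j, IsUseful V L Q seg (idx j) (f j)) ∧
        (∀ j j', Compatible (f j) (f j')) ∧
        (∀ v p u, (v, p, u) ∈ Q →
          ∃ j a b, f j v = some a ∧ f j u = some b ∧ (a, p, b) ∈ seg (idx j)) ∧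
        IsJoin f e := by
  constructor
  · intro he
    classical
    let S : Finset (Fin m) := Finset.univ.filter fun i => ∃ t ∈ Q, MapsInto (seg i) e t
    let idx := S.orderEmbOfFin rfl
    let f : Fin S.card → α → Option α := fun j => restrictTo (localDomain Q (seg (idx j)) e) e
    have hcover : ∀ v p u, (v, p, u) ∈ Q →
        ∃ j a b, f j v = some a ∧ f j u = some b ∧ (a, p, b) ∈ seg (idx j) := by
      intro v p u hvu
      obtain ⟨a, b, ha, hb, hab⟩ := he.2.2.2 v p u hvu
      rw [← hseg.2.2, Set.mem_iUnion] at hab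
      obtain ⟨i, hi⟩ := hab
      have hm : MapsInto (seg i) e (v, p, u) := ⟨a, b, ha, hb, hi⟩
      have hiS : i ∈ Set.range idx := by
        rw [Finset.range_orderEmbOfFin]
        exact Finset.mem_filter.mpr ⟨Finset.mem_univ i, _, hvu, hm⟩
      obtain ⟨j, rfl⟩ := hiS
      have hmem := mem_localDomain_of_mapsInto hvu hm
      exact ⟨j, a, b, restrictTo_eq_some.mpr ⟨hmem.1, ha⟩,
        restrictTo_eq_some.mpr ⟨hmem.2, hb⟩, hi⟩
    refine ⟨S.card, idx, f, idx.strictMono, fun j => ?_, fun j j' v a b ha hb => ?_, hcover,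
      fun v a => ⟨fun h => ?_, ?_⟩⟩
    · exact he.isUseful_restrictTo hset hG hseg
        (Finset.mem_filter.mp (S.orderEmbOfFin_mem rfl j)).2
    · exact Option.some.inj
        ((restrictTo_eq_some.mp ha).2.symm.trans (restrictTo_eq_some.mp hb).2)
    · rcases (he.1 v).mp (Option.isSome_iff_exists.mpr ⟨a, h⟩) with ⟨p, u, hvu⟩ | ⟨u, p, huv⟩
      · obtain ⟨j, b, c, hb, -⟩ := hcover _ _ _ hvu
        exact ⟨j, restrictTo_eq_some.mpr ⟨(restrictTo_eq_some.mp hb).1, h⟩⟩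
      · obtain ⟨j, b, c, -, hc, -⟩ := hcover _ _ _ huv
        exact ⟨j, restrictTo_eq_some.mpr ⟨(restrictTo_eq_some.mp hc).1, h⟩⟩
    · rintro ⟨j, hj⟩
      exact (restrictTo_eq_some.mp hj).2
  · rintro ⟨k, idx, f, -, huseful, -, hcover, hjoin⟩
    exact isTotalEmbedding_of_isJoin (fun j => hseg.2.1 (idx j)) (fun j => (huseful j).1)
      hcover hjoin

end RDF
end

section
/- Let Q be a query graph and W = {v_1, ..., v_k} a node cover of Q. For each v_i ∈ W define Q_{v_i} = { t ∈ Q : t = (s, p, v_i) for some s and p } ∪ { t ∈ Q : t = (v_i, p, o) for some p and some o ∉ W }. Then the subqueries Q_{v_1}, ..., Q_{v_k} are pairwise disjoint, their union equals Q, and each nonempty Q_{v_i} is a generalized star query with central node v_i; in particular, the tuple of the nonempty Q_{v_i} is a non-redundant decomposition of Q into generalized star queries. -/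
namespace RDF

variable {α β : Type*}

/-- Lemma: a node cover of `Q` yields a non-redundant decomposition
of `Q` into generalized star queries. -/
theorem statement3 {α β : Type*} [Countable β] [Infinite β]
    {Uso L V : Set α} (hset : Setting Uso L V)
    {Q : Set (α × β × α)} (hQ : IsQueryGraph Uso L V Q)
    {k : ℕ} (v : Fin k → α) (hv : Function.Injective v)
    (hcov : IsNodeCover L Q (Set.range v))
    (Qv : Fin k → Set (α × β × α))
    (hQv : ∀ i, Qv i =
      {t | t ∈ Q ∧ t.2.2 = v i} ∪ {t | t ∈ Q ∧ t.1 = v i ∧ t.2.2 ∉ Set.range v}) :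
    (∀ i j, i ≠ j → Qv i ∩ Qv j = ∅) ∧
    (⋃ i, Qv i) = Q ∧
    (∀ i, (Qv i).Nonempty → IsGenStar (Qv i) (v i)) := by
  refine ⟨fun i j hij => ?_, ?_, fun i hne => ⟨?_, fun t ht => ?_⟩⟩
  · ext t
    simp only [hQv, Set.mem_inter_iff, Set.mem_union, Set.mem_ofPred_eq, Set.mem_empty_iff_false,
      iff_false]
    rintro ⟨⟨-, hi⟩ | ⟨-, hi, hi'⟩, ⟨-, hj⟩ | ⟨-, hj, hj'⟩⟩
    · exact hij (hv (hi.symm.trans hj))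
    · exact hj' ⟨i, hi.symm⟩
    · exact hi' ⟨j, hj.symm⟩
    · exact hij (hv (hi.symm.trans hj))
  · ext t
    simp only [hQv, Set.mem_iUnion, Set.mem_union, Set.mem_ofPred_eq]
    constructor
    · rintro ⟨i, ⟨ht, -⟩ | ⟨ht, -⟩⟩ <;> exact ht
    · intro ht
      by_cases ho : t.2.2 ∈ Set.range v
      · obtain ⟨i, hi⟩ := ho
        exact ⟨i, Or.inl ⟨ht, hi.symm⟩⟩
      · obtain ⟨i, hi⟩ := (hcov.2 t ht).resolve_right ho
        exact ⟨i, Or.inr ⟨ht, hi.symm, ho⟩⟩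
  · obtain ⟨⟨s, p, o⟩, ht⟩ := hne
    have ht' := ht
    rw [hQv] at ht'
    rcases ht' with ⟨-, rfl⟩ | ⟨-, rfl, -⟩
    · exact Or.inr ⟨s, p, ht⟩
    · exact Or.inl ⟨p, o, ht⟩
  · rw [hQv] at ht
    rcases ht with ⟨-, h⟩ | ⟨-, h, -⟩
    · exact Or.inr h
    · exact Or.inl h

end RDF
end
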